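/- arXiv:2309.12633 — 4 statements merged into one kernel-verified Lean document; each statement's English description precedes it below -/
import Mathlib

section
/- Let T be a type of trajectories, let p and q be probability mass functions on T, let G : T → ℝ be a return function with 0 < G(τ) ≤ 1 for all τ, and let ε ∈ [0,1]. If ∑'_{τ} q(τ)·G(τ) < (1−ε)·∑'_{τ} p(τ)·G(τ), then there exists a trajectory τ with either q(τ) < (1−ε)·p(τ) or q(τ) > (1+ε)·p(τ); that is, the two trajectory distributions are not ε-similar. -/
/-- Corollary 2 of the paper: if the expected return under `q` drops below
`(1-ε)` times the expected return under `p`, then the two trajectory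
distributions are not ε-similar, i.e. the pointwise similarity condition
fails at some trajectory. -/
theorem return_drop_implies_not_eps_similar {T : Type*} (p q : T → ℝ) (G : T → ℝ) (ε : ℝ)
    (hp0 : ∀ τ, 0 ≤ p τ) (hp1 : ∑' τ, p τ = 1)
    (hq0 : ∀ τ, 0 ≤ q τ) (hq1 : ∑' τ, q τ = 1)
    (hG : ∀ τ, 0 < G τ ∧ G τ ≤ 1)
    (hε : 0 ≤ ε ∧ ε ≤ 1)
    (hdrop : ∑' τ, q τ * G τ < (1 - ε) * (∑' τ, p τ * G τ)) :
    ∃ τ, q τ < (1 - ε) * p τ ∨ q τ > (1 + ε) * p τ := by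
  by_contra! h
  have summable_mul_G {f : T → ℝ} (hf0 : ∀ τ, 0 ≤ f τ) (hf1 : ∑' τ, f τ = 1) :
      Summable fun τ => f τ * G τ := by
    have hf : Summable f := by
      by_contra hf
      simp [tsum_eq_zero_of_not_summable hf] at hf1
    exact hf.of_nonneg_of_le (fun τ => mul_nonneg (hf0 τ) (hG τ).1.le)
      fun τ => mul_le_of_le_one_right (hf0 τ) (hG τ).2
  rw [← tsum_mul_left] at hdrop
  refine hdrop.not_ge (Summable.tsum_le_tsum (fun τ => ?_)
    ((summable_mul_G hp0 hp1).mul_left _) (summable_mul_G hq0 hq1))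
  rw [← mul_assoc]
  exact mul_le_mul_of_nonneg_right (h τ).1 (hG τ).1.le
end

section
/- Let A be a finite type with cardinality k ≥ 2, and let p, q : A → ℝ be probability vectors (nonnegative, summing to 1) with q(a) > 0 for all a ∈ A. If x > 0 and (1/2)·∑_{a∈A} |p(a) − q(a)| > x, then there exist a, b ∈ A such that p(a)/q(a) > 1 + 2x/(k(k−1)) and p(b)/q(b) < 1 − 2x/(k(k−1)). -/
/-- If `d` sums to zero and its `ℓ¹` norm exceeds `2 * c * ∑ a, q a`, then `d` exceeds `c * q`
somewhere. -/
theorem exists_mul_lt_of_sum_eq_zero {A : Type*} [Fintype A] {d q : A → ℝ} {c : ℝ}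
    (hc : 0 ≤ c) (hq : ∀ a, 0 ≤ q a) (hd : ∑ a, d a = 0)
    (h : 2 * c * ∑ a, q a < ∑ a, |d a|) : ∃ a, c * q a < d a := by
  by_contra! hle
  have hsum : ∑ a, |d a| ≤ ∑ a, (2 * c * q a - d a) := by
    refine Finset.sum_le_sum fun a _ => abs_le.mpr ⟨?_, ?_⟩
    · linarith [mul_nonneg hc (hq a), hle a]
    · linarith [hle a]
  rw [Finset.sum_sub_distrib, ← Finset.mul_sum, hd] at hsum
  linarith

/-- Key per-step ratio claim in the proof of Theorem 1: if the total variation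
distance between the probability vectors `p` and `q` exceeds `x`, then the
likelihood ratio `p a / q a` exceeds `1 + 2x/(k(k-1))` at some action and
falls below `1 - 2x/(k(k-1))` at another. -/
theorem tv_gt_implies_ratio_bounds {A : Type*} [Fintype A]
    (p q : A → ℝ) (x : ℝ)
    (hk : 2 ≤ Fintype.card A)
    (hp0 : ∀ a, 0 ≤ p a) (hp1 : ∑ a, p a = 1)
    (hq0 : ∀ a, 0 < q a) (hq1 : ∑ a, q a = 1)
    (hx : 0 < x)
    (htv : (1 / 2) * ∑ a, |p a - q a| > x) :
    ∃ a b, p a / q a > 1 + 2 * x / ((Fintype.card A) * ((Fintype.card A) - 1)) ∧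
      p b / q b < 1 - 2 * x / ((Fintype.card A) * ((Fintype.card A) - 1)) := by
  set c : ℝ := 2 * x / ((Fintype.card A) * ((Fintype.card A) - 1)) with hc
  have hk' : (2 : ℝ) ≤ Fintype.card A := by exact_mod_cast hk
  have hden : (2 : ℝ) ≤ (Fintype.card A) * ((Fintype.card A) - 1) := by nlinarith
  have hc0 : 0 ≤ c := by positivity
  have hcx : c ≤ x := by
    rw [hc, div_le_iff₀ (by linarith)]
    nlinarith
  obtain ⟨a, ha⟩ := exists_mul_lt_of_sum_eq_zero (d := fun a => p a - q a) hc0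
    (fun a => (hq0 a).le) (by simp [hp1, hq1]) (by rw [hq1]; linarith)
  obtain ⟨b, hb⟩ := exists_mul_lt_of_sum_eq_zero (d := fun a => q a - p a) hc0
    (fun a => (hq0 a).le) (by simp [hp1, hq1])
    (by simp only [abs_sub_comm (q _)]; rw [hq1]; linarith)
  refine ⟨a, b, ?_, ?_⟩
  · rw [gt_iff_lt, lt_div_iff₀ (hq0 a)]
    linarith
  · rw [div_lt_iff₀ (hq0 b)]
    linarith
end

section
/- Let A be a finite type and let p, q : A → ℝ be probability vectors (nonnegative, summing to 1). Define the mixture m(a) = (p(a) + q(a))/2, and the Jensen–Shannon divergence JSD(p‖q) = (1/2)·∑_{a : p(a) > 0} p(a)·log(p(a)/m(a)) + (1/2)·∑_{a : q(a) > 0} q(a)·log(q(a)/m(a)) using the natural logarithm. Then JSD(p‖q) ≤ (1/2)·∑_{a∈A} |p(a) − q(a)|, i.e., the Jensen–Shannon divergence is bounded above by the total variation distance. -/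
open Finset

lemma mul_log_div_midpoint_le {x y : ℝ} (hx : 0 ≤ x) (hy : 0 ≤ y) :
    x * Real.log (x / ((x + y) / 2)) ≤ x * (x - y) / (x + y) := by
  rcases hx.eq_or_lt with rfl | hx
  · simp
  have hxy : 0 < x + y := by linarith
  have hlog := Real.log_le_sub_one_of_pos (show 0 < x / ((x + y) / 2) by positivity)
  calc x * Real.log (x / ((x + y) / 2)) ≤ x * (x / ((x + y) / 2) - 1) := by gcongr
    _ = x * (x - y) / (x + y) := by field_simp; ring

lemma mul_log_div_midpoint_add_le_abs_sub {x y : ℝ} (hx : 0 ≤ x) (hy : 0 ≤ y) :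
    x * Real.log (x / ((x + y) / 2)) + y * Real.log (y / ((x + y) / 2)) ≤ |x - y| := by
  have hx_le := mul_log_div_midpoint_le hx hy
  have hy_le := mul_log_div_midpoint_le hy hx
  rw [add_comm y x] at hy_le
  have habs : |x - y| ≤ x + y := abs_sub_le_iff.2 ⟨by linarith, by linarith⟩
  calc _ ≤ x * (x - y) / (x + y) + y * (y - x) / (x + y) := add_le_add hx_le hy_le
    _ = |x - y| * |x - y| / (x + y) := by rw [← add_div, abs_mul_abs_self]; ring
    _ ≤ |x - y| := div_le_of_le_mul₀ (by positivity) (abs_nonneg _) (by gcongr)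

lemma sum_filter_pos_mul {A : Type*} [Fintype A] {p : A → ℝ} (hp : ∀ a, 0 ≤ p a) (f : A → ℝ) :
    ∑ a ∈ univ.filter (fun a => 0 < p a), p a * f a = ∑ a, p a * f a :=
  sum_filter_of_ne fun a _ h => (hp a).lt_of_ne' (left_ne_zero_of_mul h)

/-- The Jensen–Shannon divergence between two probability vectors is bounded
above by their total variation distance:
`JSD(p‖q) ≤ (1/2) ∑ |p a - q a|`, where
`JSD(p‖q) = (1/2) D_KL(p‖m) + (1/2) D_KL(q‖m)` with `m = (p+q)/2`. -/
theorem jsd_le_tv {A : Type*} [Fintype A]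
    (p q : A → ℝ)
    (hp0 : ∀ a, 0 ≤ p a) (hp1 : ∑ a, p a = 1)
    (hq0 : ∀ a, 0 ≤ q a) (hq1 : ∑ a, q a = 1) :
    (1 / 2) * (∑ a ∈ univ.filter (fun a => 0 < p a),
        p a * Real.log (p a / ((p a + q a) / 2)))
      + (1 / 2) * (∑ a ∈ univ.filter (fun a => 0 < q a),
        q a * Real.log (q a / ((p a + q a) / 2)))
      ≤ (1 / 2) * ∑ a, |p a - q a| := by
  rw [sum_filter_pos_mul hp0, sum_filter_pos_mul hq0, ← mul_add, ← sum_add_distrib]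
  gcongr with a
  exact mul_log_div_midpoint_add_le_abs_sub (hp0 a) (hq0 a)
end

section
/- Let A be a finite type of actions with cardinality k ≥ 2, let T ≥ 1 be a horizon, let ε > 0, and let π, π' : List A → A → ℝ be two history-dependent policies, i.e., for every history h (a list of actions) the functions π(h) and π'(h) are nonnegative and sum to 1 over A, with π'(h)(a) > 0 for every h and a. For an action sequence σ = (a₀, …, a_{T−1}) define the likelihood ratio R(σ) = ∏_{t=0}^{T−1} π(a₀,…,a_{t−1})(a_t) / π'(a₀,…,a_{t−1})(a_t). If for every history h of length less than T the total variation distance satisfies (1/2)·∑_{a∈A} |π(h)(a) − π'(h)(a)| > (k(k−1)/2) · ((1+ε)^{1/T} − 1), then there exists an action sequence σ of length T with R(σ) > 1 + ε, and hence |1 − R(σ)| > ε. -/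
open Finset

/-- If a finite distribution `p` is at total variation distance more than `c - 1` from `q`,
then some point has `p a > c * q a`. -/
lemma exists_mul_lt_of_tv_gt {A : Type*} [Fintype A] {p q : A → ℝ} {c : ℝ} (hc : 1 ≤ c)
    (hq0 : ∀ a, 0 ≤ q a) (hp1 : ∑ a, p a = 1) (hq1 : ∑ a, q a = 1)
    (htv : c - 1 < (1 / 2) * ∑ a, |p a - q a|) : ∃ a, c * q a < p a := by
  by_contra! hle
  have hsum : ∑ a, |p a - q a| ≤ ∑ a, (2 * (c - 1) * q a - (p a - q a)) := by
    refine sum_le_sum fun a _ => ?_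
    have := mul_nonneg (sub_nonneg.2 hc) (hq0 a)
    exact abs_le.2 ⟨by linarith, by linarith [hle a]⟩
  rw [sum_sub_distrib, sum_sub_distrib, ← mul_sum, hp1, hq1] at hsum
  linarith

/-- A rule `f` choosing the next element from the preceding ones generates a sequence of
every length. -/
lemma exists_forall_eq_take_ofFn {A : Type*} (f : List A → A) (n : ℕ) :
    ∃ σ : Fin n → A, ∀ t : Fin n, σ t = f ((List.ofFn σ).take t) := by
  induction n with
  | zero => exact ⟨Fin.elim0, fun t => t.elim0⟩
  | succ n ih =>
    obtain ⟨σ, hσ⟩ := ih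
    have hofFn : List.ofFn (Fin.snoc σ (f (List.ofFn σ)) : Fin (n + 1) → A) =
        List.ofFn σ ++ [f (List.ofFn σ)] := by
      rw [List.ofFn_succ_last]
      simp
    refine ⟨Fin.snoc σ (f (List.ofFn σ)), fun t => ?_⟩
    rw [hofFn]
    refine Fin.lastCases ?_ (fun i => ?_) t
    · simp
    · rw [Fin.snoc_castSucc, Fin.val_castSucc, List.take_append_of_le_length (by simp [i.2.le])]
      exact hσ i

/-- The constructive variant of Theorem 1 carried out in the paper's proof:
if at every history of length less than the horizon `T` the total variation
distance between the policies `π` and `π'` exceeds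
`(k(k-1)/2) · ((1+ε)^(1/T) - 1)`, then there is a length-`T` action sequence
`σ` whose likelihood-ratio product
`R(σ) = ∏ₜ π(σ_{<t})(σ_t) / π'(σ_{<t})(σ_t)` exceeds `1 + ε`, and hence
`|1 - R(σ)| > ε`. -/
theorem policy_dissimilarity_of_tv_lb_greedy {A : Type*} [Fintype A]
    (hk : 2 ≤ Fintype.card A)
    (T : ℕ) (hT : 1 ≤ T) (ε : ℝ) (hε : 0 < ε)
    (π π' : List A → A → ℝ)
    (hπ0 : ∀ h a, 0 ≤ π h a) (hπ1 : ∀ h, ∑ a, π h a = 1)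
    (hπ'0 : ∀ h a, 0 ≤ π' h a) (hπ'1 : ∀ h, ∑ a, π' h a = 1)
    (hπ'pos : ∀ h a, 0 < π' h a)
    (htv : ∀ h : List A, h.length < T →
      (1 / 2) * ∑ a, |π h a - π' h a| >
        ((Fintype.card A : ℝ) * ((Fintype.card A : ℝ) - 1) / 2) *
          ((1 + ε) ^ ((1 : ℝ) / T) - 1)) :
    ∃ σ : Fin T → A,
      (∏ t : Fin T,
          π ((List.ofFn σ).take t) (σ t) / π' ((List.ofFn σ).take t) (σ t)) > 1 + ε ∧
      |1 - ∏ t : Fin T,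
          π ((List.ofFn σ).take t) (σ t) / π' ((List.ofFn σ).take t) (σ t)| > ε := by
  set c : ℝ := (1 + ε) ^ ((1 : ℝ) / T) with hc
  have hc1 : 1 ≤ c := Real.one_le_rpow (by linarith) (by positivity)
  have hcT : c ^ T = 1 + ε := by
    rw [hc, one_div, Real.rpow_inv_natCast_pow (by linarith) (by lia)]
  have hk' : (2 : ℝ) ≤ Fintype.card A := by exact_mod_cast hk
  have hcoef : (1 : ℝ) ≤ (Fintype.card A : ℝ) * ((Fintype.card A : ℝ) - 1) / 2 := by nlinarith
  have hstep (h : List A) : ∃ a, h.length < T → c * π' h a < π h a := by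
    by_cases hh : h.length < T
    · obtain ⟨a, ha⟩ := exists_mul_lt_of_tv_gt hc1 (hπ'0 h) (hπ1 h) (hπ'1 h)
        ((le_mul_of_one_le_left (sub_nonneg.2 hc1) hcoef).trans_lt (htv h hh))
      exact ⟨a, fun _ => ha⟩
    · obtain ⟨a⟩ : Nonempty A := Fintype.card_pos_iff.1 (by lia)
      exact ⟨a, fun h' => absurd h' hh⟩
  choose f hf using hstep
  obtain ⟨σ, hσ⟩ := exists_forall_eq_take_ofFn f T
  have hratio (t : Fin T) :
      c < π ((List.ofFn σ).take t) (σ t) / π' ((List.ofFn σ).take t) (σ t) := by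
    rw [lt_div_iff₀ (hπ'pos _ _), hσ t]
    exact hf _ (by simp)
  have hprod : 1 + ε < ∏ t : Fin T,
      π ((List.ofFn σ).take t) (σ t) / π' ((List.ofFn σ).take t) (σ t) := by
    have : Nonempty (Fin T) := ⟨⟨0, hT⟩⟩
    calc 1 + ε = ∏ _t : Fin T, c := by simp [hcT]
      _ < _ := prod_lt_prod_of_nonempty (fun _ _ => by linarith) (fun t _ => hratio t)
        univ_nonempty
  exact ⟨σ, hprod, lt_abs.2 (Or.inr (by linarith))⟩
end
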